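/- Let u : M⁺(ℝ^d) → ℝ be bounded, weakly continuous, with linear functional derivative δu such that x ↦ δu(μ,x) is differentiable for every μ with gradient D_μu(μ,x) := ∇ₓδu(μ,x) bounded and jointly continuous. Fix λ > 0 and n ∈ ℕ, and define ũ : (ℝ^d)ⁿ → ℝ by ũ(x₁,…,xₙ) := u((λ/n) Σᵢ₌₁ⁿ δ_{xᵢ}), where δ_x denotes the Dirac measure at x. Then ũ is continuously differentiable with bounded derivatives, and for each k ∈ {1,…,n}: ∇_{x_k} ũ(x₁,…,xₙ) = (λ/n) · D_μu((λ/n) Σᵢ₌₁ⁿ δ_{xᵢ}, x_k). -/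

import Mathlib

open MeasureTheory Set Filter Topology
open scoped NNReal ENNReal

noncomputable section

/-- `ℝ^d`. -/
abbrev Eu (d : ℕ) : Type := EuclideanSpace ℝ (Fin d)

/-- `M⁺(ℝ^d)`, the finite positive Borel measures on `ℝ^d`, with the weak topology. -/
abbrev Md (d : ℕ) : Type := MeasureTheory.FiniteMeasure (Eu d)

variable {d : ℕ}

/-- The segment `t μ' + (1 - t) μ` in the space of finite measures. -/
noncomputable def seg (μ μ' : Md d) (t : ℝ) : Md d :=
  t.toNNReal • μ' + (1 - t).toNNReal • μ

/-- `⟨μ, ψ⟩ = ∫ ψ dμ`. -/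
noncomputable def pairing (μ : Md d) (ψ : Eu d → ℝ) : ℝ :=
  ∫ x, ψ x ∂(μ : Measure (Eu d))

/-- `δu` is a linear functional derivative of `u : M⁺(ℝ^d) → ℝ`: it is bounded, jointly
continuous (weak topology on measures), and satisfies the fundamental identity. -/
def IsLFD (u : Md d → ℝ) (δu : Md d → Eu d → ℝ) : Prop :=
  (∃ C : ℝ, ∀ (μ : Md d) (x : Eu d), |δu μ x| ≤ C) ∧
  Continuous (fun p : Md d × Eu d => δu p.1 p.2) ∧
  ∀ μ μ' : Md d,
    u μ' - u μ =
      ∫ t in (0:ℝ)..1,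
        (pairing μ' (fun x => δu (seg μ μ' t) x) - pairing μ (fun x => δu (seg μ μ' t) x))

/-- The Dirac measure at `x` as a finite measure. -/
noncomputable def diracFM (x : Eu d) : Md d := ⟨Measure.dirac x, inferInstance⟩

lemma continuous_diracFM : Continuous (diracFM : Eu d → Md d) := by
  rw [FiniteMeasure.continuous_iff_forall_continuous_integral]
  intro f
  simpa [diracFM] using f.continuous

lemma pairing_smul_sum_diracFM {n : ℕ} (c : ℝ≥0) (X : Fin n → Eu d) (ψ : Eu d → ℝ) :
    pairing (c • ∑ i, diracFM (X i)) ψ = c * ∑ i, ψ (X i) := by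
  simp only [pairing, FiniteMeasure.toMeasure_smul, FiniteMeasure.toMeasure_sum]
  rw [integral_smul_nnreal_measure, integral_finsetSum_measure]
  · simp [diracFM, NNReal.smul_def]
  · intro i _
    exact integrable_dirac (by simp)

lemma continuous_seg : Continuous (fun p : (Md d × Md d) × ℝ => seg p.1.1 p.1.2 p.2) := by
  unfold seg
  fun_prop

lemma seg_self (μ : Md d) {t : ℝ} (ht : t ∈ Icc (0 : ℝ) 1) : seg μ μ t = μ := by
  rw [seg, ← add_smul, ← Real.toNNReal_add ht.1 (sub_nonneg.2 ht.2)]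
  simp

/-- First order expansion in the space variable, uniform in a compact set of parameters, of a
family of functions whose gradient is jointly continuous. -/
lemma eventually_abs_sub_sub_inner_le {P T E : Type*} [TopologicalSpace P] [TopologicalSpace T]
    [NormedAddCommGroup E] [InnerProductSpace ℝ E] [CompleteSpace E]
    {F : P → T → E → ℝ} (hF : ∀ p t, Differentiable ℝ (F p t))
    (hg : Continuous (fun q : (P × E) × T => gradient (F q.1.1 q.2) q.1.2))
    {K : Set T} (hK : IsCompact K) (p₀ : P) (x₀ g : E)
    (hx : ∀ t ∈ K, gradient (F p₀ t) x₀ = g) {ε : ℝ} (hε : 0 < ε) :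
    ∀ᶠ q : P × E in 𝓝 (p₀, x₀), ∀ t ∈ K,
      |F q.1 t q.2 - F q.1 t x₀ - inner ℝ g (q.2 - x₀)| ≤ ε * ‖q.2 - x₀‖ := by
  have hnear : ∀ᶠ q : P × E in 𝓝 (p₀, x₀), ∀ t ∈ K, ‖gradient (F q.1 t) q.2 - g‖ ≤ ε := by
    refine hK.eventually_forall_of_forall_eventually fun t ht => ?_
    have h := (hg.tendsto ((p₀, x₀), t)).eventually (Metric.closedBall_mem_nhds _ hε)
    simpa only [hx t ht, Metric.mem_closedBall, dist_eq_norm] using h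
  rw [nhds_prod_eq, eventually_prod_iff] at hnear
  obtain ⟨pa, ha, pb, hb, hab⟩ := hnear
  obtain ⟨r, hr, hball⟩ := Metric.eventually_nhds_iff_ball.1 hb
  rw [nhds_prod_eq]
  filter_upwards [prod_mem_prod ha (Metric.ball_mem_nhds x₀ hr)] with q hq t ht
  have h := (convex_ball x₀ r).norm_image_sub_le_of_norm_fderiv_le' (𝕜 := ℝ)
    (f := F q.1 t) (φ := InnerProductSpace.toDual ℝ E g) (C := ε)
    (fun z _ => hF q.1 t z) (fun z hz => ?_) (Metric.mem_ball_self hr) hq.2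
  · simpa using h
  · rw [← toDual_gradient, ← map_sub, LinearIsometryEquiv.norm_map]
    exact hab hq.1 (hball z hz) t ht

/-- The candidate for the derivative of `X ↦ u (c Σᵢ δ_{Xᵢ})`, given the gradients `g`. -/
def sumInner {n : ℕ} (c : ℝ) (g : Fin n → Eu d) : (Fin n → Eu d) →L[ℝ] ℝ :=
  c • ∑ i, (InnerProductSpace.toDual ℝ (Eu d) (g i)).comp (ContinuousLinearMap.proj i)

lemma sumInner_apply {n : ℕ} (c : ℝ) (g h : Fin n → Eu d) :
    sumInner c g h = c * ∑ i, inner ℝ (g i) (h i) := by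
  simp [sumInner]

lemma continuous_sumInner {n : ℕ} (c : ℝ) :
    Continuous (sumInner c : (Fin n → Eu d) → (Fin n → Eu d) →L[ℝ] ℝ) := by
  unfold sumInner
  refine Continuous.const_smul (continuous_finsetSum _ fun i _ => ?_) c
  exact ((InnerProductSpace.toDual ℝ (Eu d)).continuous.comp (continuous_apply i)).clm_comp
    continuous_const

lemma norm_sumInner_le {n : ℕ} {c C : ℝ} (hc : 0 ≤ c) (hC : 0 ≤ C) {g : Fin n → Eu d}
    (hg : ∀ i, ‖g i‖ ≤ C) : ‖sumInner c g‖ ≤ c * (n * C) := by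
  refine ContinuousLinearMap.opNorm_le_bound _ (by positivity) fun h => ?_
  rw [sumInner_apply, norm_mul, Real.norm_of_nonneg hc, mul_assoc]
  gcongr
  calc ‖∑ i, inner ℝ (g i) (h i)‖ ≤ ∑ _i : Fin n, C * ‖h‖ := norm_sum_le_of_le _ fun i _ =>
        (norm_inner_le_norm _ _).trans (mul_le_mul (hg i) (norm_le_pi_norm h i) (by positivity) hC)
    _ = n * C * ‖h‖ := by simp [mul_assoc]

lemma hasFDerivAt_comp_smul_sum_diracFM {n : ℕ} {u : Md d → ℝ} {δu : Md d → Eu d → ℝ}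
    (hu : IsLFD u δu) (hdiff : ∀ μ : Md d, Differentiable ℝ (δu μ))
    (hgc : Continuous (fun p : Md d × Eu d => gradient (δu p.1) p.2)) (c : ℝ≥0)
    {emp : (Fin n → Eu d) → Md d} (hemp : ∀ X, emp X = c • ∑ i, diracFM (X i))
    (hcont : Continuous emp) (X : Fin n → Eu d) :
    HasFDerivAt (fun Y => u (emp Y))
      (sumInner c fun i => gradient (δu (emp X)) (X i)) X := by
  obtain ⟨-, hδc, hid⟩ := hu
  rw [hasFDerivAt_iff_isLittleO, Asymptotics.isLittleO_iff]
  intro ε hε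
  have hε' : 0 < ε / (c * n + 1) := by positivity
  have hseg : Continuous (fun q : (Fin n → Eu d) × ℝ => seg (emp X) (emp q.1) q.2) :=
    continuous_seg.comp (f := fun q : (Fin n → Eu d) × ℝ => ((emp X, emp q.1), q.2))
      (by fun_prop)
  have key : ∀ᶠ Y in 𝓝 X, ∀ i, ∀ t ∈ Icc (0 : ℝ) 1,
      |δu (seg (emp X) (emp Y) t) (Y i) - δu (seg (emp X) (emp Y) t) (X i)
        - inner ℝ (gradient (δu (emp X)) (X i)) (Y i - X i)|
        ≤ ε / (c * n + 1) * ‖Y i - X i‖ := by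
    rw [eventually_all]
    intro i
    have h := eventually_abs_sub_sub_inner_le
      (F := fun (Y : Fin n → Eu d) (t : ℝ) => δu (seg (emp X) (emp Y) t))
      (fun _ _ => hdiff _)
      (hgc.comp (f := fun q : ((Fin n → Eu d) × Eu d) × ℝ =>
        (seg (emp X) (emp q.1.1) q.2, q.1.2))
        ((hseg.comp (f := fun q : ((Fin n → Eu d) × Eu d) × ℝ => (q.1.1, q.2))
          (by fun_prop)).prodMk (by fun_prop)))
      (isCompact_Icc (a := (0 : ℝ)) (b := 1)) X (X i) (gradient (δu (emp X)) (X i))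
      (fun t ht => by rw [seg_self _ ht]) hε'
    have hY : Tendsto (fun Y : Fin n → Eu d => (Y, Y i)) (𝓝 X) (𝓝 (X, X i)) :=
      Continuous.tendsto (by fun_prop) X
    exact hY.eventually h
  filter_upwards [key] with Y hY
  have hcontt : ∀ Z : Fin n → Eu d, Continuous fun t : ℝ =>
      ∑ i, δu (seg (emp X) (emp Y) t) (Z i) := fun Z =>
    continuous_finsetSum _ fun i _ => hδc.comp
      (f := fun t : ℝ => (seg (emp X) (emp Y) t, Z i))
      ((hseg.comp (f := fun t : ℝ => (Y, t)) (by fun_prop)).prodMk continuous_const)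
  have hpair : ∀ (Z : Fin n → Eu d) (ψ : Eu d → ℝ),
      pairing (emp Z) ψ = c * ∑ i, ψ (Z i) := fun Z ψ => by
    rw [hemp, pairing_smul_sum_diracFM]
  have hrepr : u (emp Y) - u (emp X) - sumInner c (fun i => gradient (δu (emp X)) (X i)) (Y - X)
      = ∫ t in (0 : ℝ)..1, c * ∑ i, (δu (seg (emp X) (emp Y) t) (Y i)
        - δu (seg (emp X) (emp Y) t) (X i)
        - inner ℝ (gradient (δu (emp X)) (X i)) (Y i - X i)) := by
    simp only [hid, hpair, Finset.sum_sub_distrib, mul_sub]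
    rw [eq_comm]
    refine (intervalIntegral.integral_sub
      ((((hcontt Y).const_mul _).sub ((hcontt X).const_mul _)).intervalIntegrable _ _)
      intervalIntegrable_const).trans ?_
    rw [intervalIntegral.integral_const, sumInner_apply]
    simp
  rw [hrepr]
  refine (intervalIntegral.norm_integral_le_of_norm_le_const
    (C := c * (n * (ε / (c * n + 1) * ‖Y - X‖))) fun t ht => ?_).trans ?_
  · rw [uIoc_of_le zero_le_one] at ht
    rw [norm_mul, Real.norm_of_nonneg c.coe_nonneg]
    gcongr
    refine (norm_sum_le_of_le _ fun i _ => (hY i t (Ioc_subset_Icc_self ht)).trans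
      (mul_le_mul_of_nonneg_left (norm_le_pi_norm (Y - X) i) hε'.le)).trans_eq ?_
    simp
  · have h : (c : ℝ) * n / (c * n + 1) ≤ 1 := by
      rw [div_le_one (by positivity)]
      linarith
    calc (c : ℝ) * (n * (ε / (c * n + 1) * ‖Y - X‖)) * |1 - 0|
        = c * n / (c * n + 1) * (ε * ‖Y - X‖) := by simp; ring
      _ ≤ 1 * (ε * ‖Y - X‖) := by gcongr
      _ = ε * ‖Y - X‖ := one_mul _

/-- differentiability of the empirical projection. If `u` is bounded,
weakly continuous with linear functional derivative `δu` such that `x ↦ δu(μ,x)` is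
differentiable with gradient `D_μu(μ,x) = ∇ₓδu(μ,x)` bounded and jointly continuous,
then for `λ > 0` and `n ∈ ℕ` the map `ũ(x₁,…,xₙ) = u((λ/n) Σᵢ δ_{xᵢ})` is continuously
differentiable with bounded derivative, and
`∇_{x_k}ũ(x₁,…,xₙ) = (λ/n) D_μu((λ/n) Σᵢ δ_{xᵢ}, x_k)`. -/
theorem stmt12 {n : ℕ} (u : Md d → ℝ) (δu : Md d → Eu d → ℝ)
    (hub : ∃ C : ℝ, ∀ μ : Md d, |u μ| ≤ C) (huc : Continuous u) (hu : IsLFD u δu)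
    (hdiff : ∀ μ : Md d, Differentiable ℝ (δu μ))
    (hgb : ∃ C : ℝ, ∀ (μ : Md d) (x : Eu d), ‖gradient (δu μ) x‖ ≤ C)
    (hgc : Continuous (fun p : Md d × Eu d => gradient (δu p.1) p.2))
    (lam : ℝ) (hlam : 0 < lam)
    (emp : (Fin n → Eu d) → Md d)
    (hemp : emp = fun X => (lam / (n : ℝ)).toNNReal • ∑ i : Fin n, diracFM (X i))
    (ut : (Fin n → Eu d) → ℝ) (hut : ut = fun X => u (emp X)) :
    ContDiff ℝ 1 ut ∧
    (∃ C : ℝ, ∀ X : Fin n → Eu d, ‖fderiv ℝ ut X‖ ≤ C) ∧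
    ∀ (X : Fin n → Eu d) (k : Fin n),
      gradient (fun z : Eu d => ut (Function.update X k z)) (X k) =
        (lam / (n : ℝ)) • gradient (δu (emp X)) (X k) := by
  have hc : ((lam / (n : ℝ)).toNNReal : ℝ) = lam / n :=
    Real.coe_toNNReal _ (by positivity)
  have hcont : Continuous emp := by
    rw [hemp]
    have hsum : Continuous fun X : Fin n → Eu d => ∑ i, diracFM (X i) :=
      continuous_finsetSum _ fun i _ => continuous_diracFM.comp (continuous_apply i)
    exact hsum.const_smul (lam / (n : ℝ)).toNNReal
  have hderiv : ∀ X, HasFDerivAt ut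
      (sumInner (lam / n) fun i => gradient (δu (emp X)) (X i)) X := fun X => by
    rw [hut, ← hc]
    exact hasFDerivAt_comp_smul_sum_diracFM hu hdiff hgc _ (fun X => by rw [hemp]) hcont X
  refine ⟨contDiff_one_iff_hasFDerivAt.2 ⟨_, ?_, hderiv⟩, ?_, fun X k => ?_⟩
  · exact (continuous_sumInner _).comp (continuous_pi fun i =>
      hgc.comp (hcont.prodMk (continuous_apply i)))
  · obtain ⟨C, hC⟩ := hgb
    exact ⟨_, fun X => (hderiv X).fderiv ▸ norm_sumInner_le (by positivity)
      ((norm_nonneg _).trans (hC 0 0)) fun i => hC _ _⟩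
  · refine HasGradientAt.gradient ?_
    have h := hderiv X
    rw [← Function.update_eq_self k X] at h
    rw [hasGradientAt_iff_hasFDerivAt]
    refine (h.comp (X k) (hasFDerivAt_update X (X k))).congr_fderiv ?_
    ext v
    have hsum : ∀ i, (Pi.single (M := fun _ : Fin n => Eu d →L[ℝ] Eu d) k
        (ContinuousLinearMap.id ℝ (Eu d)) i) v = if i = k then v else 0 := fun i => by
      by_cases hik : i = k
      · subst hik; simp
      · simp [hik]
    simp [sumInner_apply, hsum, apply_ite]

end
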